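/- Let E ∈ M(J,{n_k},{c_k}) be a Moran set with inf_k c_k > 0. Then dim_H E = liminf_{k→∞} log(n₁⋯n_k)/(−log(c₁⋯c_k)) and dim_P E = limsup_{k→∞} log(n₁⋯n_k)/(−log(c₁⋯c_k)), where dim_H and dim_P denote Hausdorff and packing dimension respectively; moreover the lower and upper box-counting dimensions of E equal the same liminf and limsup. -/

import Mathlib

open scoped ENNReal

noncomputable section

open Filter MeasureTheory

/-- A compact set `A` is *homogeneous* with respect to the Borel probability measure `μ`
supported on `A` and constants `lam ≥ 1`, `kappa ∈ (0,1)`, `1 < del ≤ Del`. -/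
structure IsHomog {X : Type*} [MetricSpace X] [MeasurableSpace X]
    (A : Set X) (μ : Measure X) (lam kappa del Del : ℝ) : Prop where
  compact : IsCompact A
  diam_pos : 0 < Metric.diam A
  prob : IsProbabilityMeasure μ
  supp_null : μ Aᶜ = 0
  supp_pos : ∀ x ∈ A, ∀ r : ℝ, 0 < r → 0 < μ (Metric.closedBall x r)
  one_le_lam : 1 ≤ lam
  ratio_le : ∀ x₁ ∈ A, ∀ x₂ ∈ A, ∀ r : ℝ, 0 < r → r ≤ Metric.diam A →
    (μ (Metric.closedBall x₁ r)).toReal ≤ lam * (μ (Metric.closedBall x₂ r)).toReal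
  kappa_pos : 0 < kappa
  kappa_lt_one : kappa < 1
  one_lt_del : 1 < del
  del_le_Del : del ≤ Del
  scale_lower : ∀ x ∈ A, ∀ r : ℝ, 0 < r → r ≤ Metric.diam A →
    del * (μ (Metric.closedBall x (kappa * r))).toReal ≤ (μ (Metric.closedBall x r)).toReal
  scale_upper : ∀ x ∈ A, ∀ r : ℝ, 0 < r → r ≤ Metric.diam A →
    (μ (Metric.closedBall x r)).toReal ≤ Del * (μ (Metric.closedBall x (kappa * r))).toReal

/-- `alphaPt μ x r = log μ(B(x,r)) / log r`. -/
def alphaPt {X : Type*} [MetricSpace X] [MeasurableSpace X]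
    (μ : Measure X) (x : X) (r : ℝ) : ℝ :=
  Real.log (μ (Metric.closedBall x r)).toReal / Real.log r

/-- `g ∼ h` : `|h r - g r| = O(1/|log r|)` as `r → 0⁺`. -/
def EquivNearZero (g h : ℝ → ℝ) : Prop :=
  ∃ C : ℝ, 0 < C ∧ ∃ δ : ℝ, 0 < δ ∧ ∀ r : ℝ, 0 < r → r < δ → |h r - g r| ≤ C / |Real.log r|

/-- `g` is a representative of the equivalence class `[α_A(x,·)]` of the homogeneous set `A`. -/
def IsAlphaRep {X : Type*} [MetricSpace X] [MeasurableSpace X]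
    (A : Set X) (μ : Measure X) (g : ℝ → ℝ) : Prop :=
  ∃ x ∈ A, EquivNearZero g (fun r => alphaPt μ x r)

/-- `χ(A,B)` computed from representatives `g` of `[α_A]` and `h` of `[α_B]`. -/
def chiFun (g h : ℝ → ℝ) : ℝ :=
  Filter.limsup (fun r => |Real.log (g r / h r)|) (nhdsWithin (0 : ℝ) (Set.Ioi 0))

/-- `N(A,r)`: the smallest number of closed balls of radius `r` needed to cover `A`. -/
def coverNum {X : Type*} [MetricSpace X] (A : Set X) (r : ℝ) : ℕ :=
  sInf {m : ℕ | ∃ s : Finset X, s.card = m ∧ A ⊆ ⋃ x ∈ s, Metric.closedBall x r}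

/-- Lower box-counting dimension. -/
def lowerBoxDim {X : Type*} [MetricSpace X] (A : Set X) : ℝ :=
  Filter.liminf (fun r : ℝ => Real.log (coverNum A r : ℝ) / (-Real.log r))
    (nhdsWithin (0 : ℝ) (Set.Ioi 0))

/-- Upper box-counting dimension. -/
def upperBoxDim {X : Type*} [MetricSpace X] (A : Set X) : ℝ :=
  Filter.limsup (fun r : ℝ => Real.log (coverNum A r : ℝ) / (-Real.log r))
    (nhdsWithin (0 : ℝ) (Set.Ioi 0))

/-- Radius-based packing premeasure. -/
def packPre {X : Type*} [MetricSpace X] (A : Set X) (s : ℝ) : ℝ≥0∞ :=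
  ⨅ (δ : ℝ) (_ : 0 < δ),
    ⨆ (m : ℕ) (x : Fin m → X) (ρ : Fin m → ℝ) (_ : ∀ i, x i ∈ A)
      (_ : ∀ i, 0 < ρ i ∧ ρ i ≤ δ)
      (_ : ∀ i j, i ≠ j →
        Disjoint (Metric.closedBall (x i) (ρ i)) (Metric.closedBall (x j) (ρ j))),
      ∑ i, ENNReal.ofReal (ρ i ^ s)

/-- Radius-based packing measure. -/
def packMeasure {X : Type*} [MetricSpace X] (A : Set X) (s : ℝ) : ℝ≥0∞ :=
  ⨅ (F : ℕ → Set X) (_ : A ⊆ ⋃ m, F m), ∑' m, packPre (F m) s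

/-- Radius-based packing dimension. -/
def packDim {X : Type*} [MetricSpace X] (A : Set X) : ℝ :=
  sInf {s : ℝ | 0 ≤ s ∧ packMeasure A s = 0}

/-- Distance between two sets, valued in `ℝ≥0∞`. -/
def setDistE {X : Type*} [MetricSpace X] (E F : Set X) : ℝ≥0∞ :=
  ⨅ (a : X) (_ : a ∈ E) (b : X) (_ : b ∈ F), edist a b

/-- Uniformly disconnected set. -/
def UnifDisconn {X : Type*} [MetricSpace X] (A : Set X) : Prop :=
  ∃ C : ℝ, 1 < C ∧ ∃ rstar : ℝ, 0 < rstar ∧ ∀ x ∈ A, ∀ r : ℝ, 0 < r → r < rstar →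
    ∃ E : Set X, E ⊆ A ∧ A ∩ Metric.closedBall x r ⊆ E ∧
      E ⊆ Metric.closedBall x (C * r) ∧ ENNReal.ofReal r < setDistE E (A \ E)

/-- `A` can be bilipschitz embedded into `B`. -/
def BilipEmbed {X Y : Type*} [MetricSpace X] [MetricSpace Y] (A : Set X) (B : Set Y) : Prop :=
  ∃ (f : X → Y) (L : ℝ), 1 ≤ L ∧ Set.MapsTo f A B ∧ Set.InjOn f A ∧
    ∀ x₁ ∈ A, ∀ x₂ ∈ A,
      dist x₁ x₂ / L ≤ dist (f x₁) (f x₂) ∧ dist (f x₁) (f x₂) ≤ L * dist x₁ x₂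

/-- `A` and `B` are bilipschitz equivalent. -/
def BilipEquivSets {X Y : Type*} [MetricSpace X] [MetricSpace Y] (A : Set X) (B : Set Y) :
    Prop :=
  ∃ (f : X → Y) (L : ℝ), 1 ≤ L ∧ Set.BijOn f A B ∧
    ∀ x₁ ∈ A, ∀ x₂ ∈ A,
      dist x₁ x₂ / L ≤ dist (f x₁) (f x₂) ∧ dist (f x₁) (f x₂) ≤ L * dist x₁ x₂

/-- `A` and `B` are quasi-Lipschitz equivalent. -/
def QuasiLipEquiv {X Y : Type*} [MetricSpace X] [MetricSpace Y] (A : Set X) (B : Set Y) : Prop :=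
  ∃ f : X → Y, Set.BijOn f A B ∧
    ∀ ε : ℝ, 0 < ε → ∃ δ : ℝ, 0 < δ ∧ ∀ x₁ ∈ A, ∀ x₂ ∈ A,
      0 < dist x₁ x₂ → dist x₁ x₂ < δ →
      |Real.log (dist (f x₁) (f x₂)) / Real.log (dist x₁ x₂) - 1| < ε

/-- Ahlfors–David `s`-regular set. -/
def IsADRegular {X : Type*} [MetricSpace X] [MeasurableSpace X] (A : Set X) (s : ℝ) : Prop :=
  IsCompact A ∧ 0 < Metric.diam A ∧
    ∃ (μ : Measure X) (c : ℝ), 1 ≤ c ∧ μ Aᶜ = 0 ∧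
      ∀ x ∈ A, ∀ r : ℝ, 0 < r → r ≤ Metric.diam A →
        ENNReal.ofReal (c⁻¹ * r ^ s) ≤ μ (Metric.closedBall x r) ∧
          μ (Metric.closedBall x r) ≤ ENNReal.ofReal (c * r ^ s)

/-- `n₁ ⋯ n_k` (with `0`-based indexing of the sequence `n`). -/
def prodN (n : ℕ → ℕ) (k : ℕ) : ℕ := ∏ i ∈ Finset.range k, n i

/-- `c₁ ⋯ c_k` (with `0`-based indexing of the sequence `c`). -/
def prodC (c : ℕ → ℝ) (k : ℕ) : ℝ := ∏ i ∈ Finset.range k, c i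

/-- Admissible word for the branching sequence `n`. -/
def AdmWord (n : ℕ → ℕ) (w : List ℕ) : Prop := ∀ i : Fin w.length, w.get i < n i.val

/-- A Moran structure on `J ⊆ ℝ^d` with branching numbers `n` and ratios `c`:
`Jw w` is the basic set indexed by the word `w`. -/
structure IsMoranSystem {d : ℕ} (J : Set (EuclideanSpace ℝ (Fin d))) (n : ℕ → ℕ)
    (c : ℕ → ℝ) (Jw : List ℕ → Set (EuclideanSpace ℝ (Fin d))) : Prop where
  compact : IsCompact J
  int_nonempty : (interior J).Nonempty
  two_le_n : ∀ k, 2 ≤ n k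
  c_pos : ∀ k, 0 < c k
  c_lt_one : ∀ k, c k < 1
  c_inf_pos : ∃ c₀ : ℝ, 0 < c₀ ∧ ∀ k, c₀ ≤ c k
  root : Jw [] = J
  subset : ∀ w : List ℕ, AdmWord n w → ∀ i : ℕ, i < n w.length → Jw (w ++ [i]) ⊆ Jw w
  similar : ∀ w : List ℕ, AdmWord n w → ∀ i : ℕ, i < n w.length →
    ∃ S : EuclideanSpace ℝ (Fin d) → EuclideanSpace ℝ (Fin d),
      (∀ x y, dist (S x) (S y) = c w.length * dist x y) ∧ Jw (w ++ [i]) = S '' Jw w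
  disj_int : ∀ w : List ℕ, AdmWord n w → ∀ i : ℕ, i < n w.length → ∀ j : ℕ, j < n w.length →
    i ≠ j → Disjoint (interior (Jw (w ++ [i]))) (interior (Jw (w ++ [j])))

/-- The Moran set determined by the family `Jw`. -/
def moranSet {d : ℕ} (n : ℕ → ℕ) (Jw : List ℕ → Set (EuclideanSpace ℝ (Fin d))) :
    Set (EuclideanSpace ℝ (Fin d)) :=
  ⋂ k : ℕ, ⋃ (w : List ℕ) (_ : w.length = k ∧ AdmWord n w), Jw w

/-- The index `k` such that `(c₁⋯c_k)·D < r ≤ (c₁⋯c_{k-1})·D`. -/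
def levelOf (c : ℕ → ℝ) (D r : ℝ) : ℕ := sInf {k : ℕ | prodC c k * D < r}

/-- `Φ(r) = n₁⋯n_k` whenever `(c₁⋯c_k)·D < r ≤ (c₁⋯c_{k-1})·D`, where `D = |J|`. -/
def Phi (n : ℕ → ℕ) (c : ℕ → ℝ) (D r : ℝ) : ℕ := prodN n (levelOf c D r)

section Limits

variable {α : Type*} {l : Filter α} {f g : α → ℝ}

lemma isBoundedUnder_le_of_tendsto_sub (hfg : Tendsto (fun x => f x - g x) l (nhds 0))
    (hg : l.IsBoundedUnder (· ≤ ·) g) : l.IsBoundedUnder (· ≤ ·) f := by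
  obtain ⟨b, hb⟩ := hg
  refine ⟨b + 1, ?_⟩
  simp only [eventually_map] at hb ⊢
  filter_upwards [hb, hfg.eventually (gt_mem_nhds one_pos)] with x h1 h2
  linarith

lemma isBoundedUnder_ge_of_tendsto_sub (hfg : Tendsto (fun x => f x - g x) l (nhds 0))
    (hg : l.IsBoundedUnder (· ≥ ·) g) : l.IsBoundedUnder (· ≥ ·) f := by
  obtain ⟨b, hb⟩ := hg
  refine ⟨b - 1, ?_⟩
  simp only [eventually_map] at hb ⊢
  filter_upwards [hb, hfg.eventually (lt_mem_nhds (by norm_num : (-1 : ℝ) < 0))] with x h1 h2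
  linarith

lemma limsup_le_limsup_of_tendsto_sub [l.NeBot] (hfg : Tendsto (fun x => f x - g x) l (nhds 0))
    (hle : l.IsBoundedUnder (· ≤ ·) g) (hge : l.IsBoundedUnder (· ≥ ·) g) :
    limsup f l ≤ limsup g l := by
  refine le_of_forall_pos_le_add fun ε hε => ?_
  refine limsup_le_of_le (isBoundedUnder_ge_of_tendsto_sub hfg hge).isCoboundedUnder_le ?_
  filter_upwards [eventually_lt_of_limsup_lt (lt_add_of_pos_right (limsup g l) (half_pos hε)) hle,
    hfg.eventually (gt_mem_nhds (half_pos hε))] with x h1 h2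
  linarith

lemma liminf_le_liminf_of_tendsto_sub [l.NeBot] (hfg : Tendsto (fun x => f x - g x) l (nhds 0))
    (hle : l.IsBoundedUnder (· ≤ ·) g) (hge : l.IsBoundedUnder (· ≥ ·) g) :
    liminf g l ≤ liminf f l := by
  refine le_of_forall_pos_sub_le fun ε hε => ?_
  refine le_liminf_of_le (isBoundedUnder_le_of_tendsto_sub hfg hle).isCoboundedUnder_ge ?_
  filter_upwards [eventually_lt_of_lt_liminf (sub_lt_self (liminf g l) (half_pos hε)) hge,
    hfg.eventually (lt_mem_nhds (neg_lt_zero.2 (half_pos hε)))] with x h1 h2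
  linarith

lemma tendsto_sub_comm_zero (hfg : Tendsto (fun x => f x - g x) l (nhds 0)) :
    Tendsto (fun x => g x - f x) l (nhds 0) := by
  simpa using hfg.neg

lemma limsup_eq_of_tendsto_sub [l.NeBot] (hfg : Tendsto (fun x => f x - g x) l (nhds 0))
    (hle : l.IsBoundedUnder (· ≤ ·) g) (hge : l.IsBoundedUnder (· ≥ ·) g) :
    limsup f l = limsup g l :=
  le_antisymm (limsup_le_limsup_of_tendsto_sub hfg hle hge)
    (limsup_le_limsup_of_tendsto_sub (tendsto_sub_comm_zero hfg)
      (isBoundedUnder_le_of_tendsto_sub hfg hle) (isBoundedUnder_ge_of_tendsto_sub hfg hge))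

lemma liminf_eq_of_tendsto_sub [l.NeBot] (hfg : Tendsto (fun x => f x - g x) l (nhds 0))
    (hle : l.IsBoundedUnder (· ≤ ·) g) (hge : l.IsBoundedUnder (· ≥ ·) g) :
    liminf f l = liminf g l :=
  le_antisymm
    (liminf_le_liminf_of_tendsto_sub (tendsto_sub_comm_zero hfg)
      (isBoundedUnder_le_of_tendsto_sub hfg hle) (isBoundedUnder_ge_of_tendsto_sub hfg hge))
    (liminf_le_liminf_of_tendsto_sub hfg hle hge)

end Limits

/-- `E` carries a probability measure `μ` for which the mass of a ball of radius `r ≤ r₀` is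
comparable to `(Φ r)⁻¹`, and `E` is covered by `Φ r` balls of radius `r`. -/
structure IsScaleMeasure {X : Type*} [MetricSpace X] [MeasurableSpace X]
    (E : Set X) (μ : Measure X) (Φ : ℝ → ℝ) (M r₀ : ℝ) : Prop where
  prob : IsProbabilityMeasure μ
  full : μ E = 1
  M_pos : 0 < M
  r₀_pos : 0 < r₀
  one_le : ∀ r, 1 ≤ Φ r
  le_measure : ∀ x ∈ E, ∀ r, 0 < r → r ≤ r₀ → (Φ r)⁻¹ ≤ μ.real (Metric.closedBall x r)
  measure_le : ∀ x, ∀ r, 0 < r → r ≤ r₀ → μ.real (Metric.closedBall x r) ≤ M * (Φ r)⁻¹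
  cover : ∀ r, 0 < r → r ≤ r₀ →
    ∃ s : Finset X, (s.card : ℝ) ≤ Φ r ∧ E ⊆ ⋃ x ∈ s, Metric.closedBall x r
  bounded : (nhdsWithin (0 : ℝ) (Set.Ioi 0)).IsBoundedUnder (· ≤ ·)
    (fun r => Real.log (Φ r) / -Real.log r)

lemma eventually_pos_and_le {δ : ℝ} (hδ : 0 < δ) :
    ∀ᶠ r in nhdsWithin (0 : ℝ) (Set.Ioi 0), 0 < r ∧ r ≤ δ := by
  filter_upwards [Ioc_mem_nhdsGT hδ] with r hr using hr

lemma exists_forall_of_eventually_nhdsGT {p : ℝ → Prop}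
    (hp : ∀ᶠ r in nhdsWithin (0 : ℝ) (Set.Ioi 0), p r) :
    ∃ δ : ℝ, 0 < δ ∧ ∀ r, 0 < r → r ≤ δ → p r := by
  obtain ⟨δ, hδ, hsub⟩ := mem_nhdsGT_iff_exists_Ioc_subset.1 hp
  exact ⟨δ, hδ, fun r h0 h1 => hsub ⟨h0, h1⟩⟩

lemma lt_rpow_neg_of_log_div_lt {φ r s : ℝ} (hφ : 0 < φ) (hr : 0 < r) (hr1 : r < 1)
    (h : Real.log φ / -Real.log r < s) : φ < r ^ (-s) := by
  have hl := Real.log_neg hr hr1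
  rw [Real.lt_rpow_iff_log_lt hφ hr]
  rw [div_lt_iff₀ (by linarith)] at h
  linarith

lemma rpow_neg_lt_of_lt_log_div {φ r s : ℝ} (hφ : 0 < φ) (hr : 0 < r) (hr1 : r < 1)
    (h : s < Real.log φ / -Real.log r) : r ^ (-s) < φ := by
  have hl := Real.log_neg hr hr1
  rw [Real.rpow_lt_iff_lt_log hr hφ]
  rw [lt_div_iff₀ (by linarith)] at h
  linarith

/-- Either a set contains arbitrarily large finite `r`-separated subsets, or it has a finite
maximal one. -/
lemma exists_separated {X : Type*} [MetricSpace X] (A : Set X) {r : ℝ} (hr : 0 ≤ r) (m : ℕ) :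
    ∃ S : Finset X, (S : Set X) ⊆ A ∧ (∀ x ∈ S, ∀ y ∈ S, x ≠ y → r < dist x y) ∧
      (S.card = m ∨ A ⊆ ⋃ x ∈ S, Metric.closedBall x r) := by
  classical
  induction m with
  | zero => exact ⟨∅, by simp⟩
  | succ m ih =>
    obtain ⟨S, hSA, hsep, hS⟩ := ih
    by_cases hc : A ⊆ ⋃ x ∈ S, Metric.closedBall x r
    · exact ⟨S, hSA, hsep, Or.inr hc⟩
    have hcard := hS.resolve_right hc
    obtain ⟨a, haA, ha⟩ := Set.not_subset.1 hc
    simp only [Set.mem_iUnion, Metric.mem_closedBall, exists_prop, not_exists, not_and,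
      not_le] at ha
    have haS : a ∉ S := fun haS => by
      have := ha a haS
      rw [dist_self] at this
      linarith
    refine ⟨insert a S, ?_, ?_, Or.inl ?_⟩
    · simp [Set.insert_subset_iff, haA, hSA]
    · intro x hx y hy hxy
      rcases Finset.mem_insert.1 hx with h1 | h1 <;> rcases Finset.mem_insert.1 hy with h2 | h2
      · exact absurd (h1.trans h2.symm) hxy
      · rw [h1]; exact ha y h2
      · rw [h2, dist_comm]; exact ha x h1
      · exact hsep x h1 y h2 hxy
    · rw [Finset.card_insert_of_notMem haS, hcard]

namespace IsScaleMeasure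

variable {X : Type*} [MetricSpace X] [MeasurableSpace X] {E : Set X} {μ : Measure X}
  {Φ : ℝ → ℝ} {M r₀ : ℝ}

lemma pos (h : IsScaleMeasure E μ Φ M r₀) (r : ℝ) : 0 < Φ r := one_pos.trans_le (h.one_le r)

lemma eventually_nonneg (h : IsScaleMeasure E μ Φ M r₀) :
    ∀ᶠ r in nhdsWithin (0 : ℝ) (Set.Ioi 0), 0 ≤ Real.log (Φ r) / -Real.log r := by
  filter_upwards [eventually_pos_and_le one_pos] with r hr
  exact div_nonneg (Real.log_nonneg (h.one_le r))
    (neg_nonneg.2 (Real.log_nonpos hr.1.le hr.2))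

lemma bounded_ge (h : IsScaleMeasure E μ Φ M r₀) :
    (nhdsWithin (0 : ℝ) (Set.Ioi 0)).IsBoundedUnder (· ≥ ·)
      (fun r => Real.log (Φ r) / -Real.log r) :=
  ⟨0, h.eventually_nonneg⟩

lemma liminf_nonneg (h : IsScaleMeasure E μ Φ M r₀) :
    0 ≤ liminf (fun r => Real.log (Φ r) / -Real.log r) (nhdsWithin (0 : ℝ) (Set.Ioi 0)) :=
  le_liminf_of_le h.bounded.isCoboundedUnder_ge h.eventually_nonneg

lemma limsup_nonneg (h : IsScaleMeasure E μ Φ M r₀) :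
    0 ≤ limsup (fun r => Real.log (Φ r) / -Real.log r) (nhdsWithin (0 : ℝ) (Set.Ioi 0)) :=
  h.liminf_nonneg.trans (liminf_le_limsup h.bounded h.bounded_ge)

lemma dimH_le [BorelSpace X] (h : IsScaleMeasure E μ Φ M r₀) {s : NNReal}
    (hs : liminf (fun r => Real.log (Φ r) / -Real.log r) (nhdsWithin (0 : ℝ) (Set.Ioi 0)) < s) :
    dimH E ≤ s := by
  have hfr := (frequently_lt_of_liminf_lt h.bounded.isCoboundedUnder_ge hs).and_eventually
    (eventually_pos_and_le (lt_min h.r₀_pos (by norm_num : (0 : ℝ) < 1 / 2)))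
  obtain ⟨u, hu, hu'⟩ := exists_seq_forall_of_frequently hfr
  choose S hSc hSE using fun j => h.cover (u j) (hu' j).2.1 ((hu' j).2.2.trans (min_le_left _ _))
  apply dimH_le_of_hausdorffMeasure_ne_top
  have hu0 : Tendsto u atTop (nhds 0) := hu.mono_right nhdsWithin_le_nhds
  have hlim : Tendsto (fun j => ENNReal.ofReal (2 * u j)) atTop (nhds 0) := by
    have := ENNReal.tendsto_ofReal (hu0.const_mul 2)
    simpa using this
  have hdiam : ∀ j, ∀ x : X, Metric.ediam (Metric.closedBall x (u j)) ≤
      ENNReal.ofReal (2 * u j) := by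
    intro j x
    rw [ENNReal.ofReal_mul (by norm_num), ← Metric.closedEBall_ofReal (hu' j).2.1.le]
    simpa using Metric.ediam_closedEBall_le
  have key := Measure.hausdorffMeasure_le_liminf_sum (s : ℝ) E _ hlim
    (fun j (i : S j) => Metric.closedBall (i : X) (u j))
    (Eventually.of_forall fun j i => hdiam j i)
    (Eventually.of_forall fun j => by
      intro x hx
      obtain ⟨y, hy, hxy⟩ := Set.mem_iUnion₂.1 (hSE j hx)
      exact Set.mem_iUnion.2 ⟨⟨y, hy⟩, hxy⟩)
  refine ne_top_of_le_ne_top (ENNReal.ofReal_ne_top (r := 2 ^ (s : ℝ))) (key.trans ?_)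
  refine liminf_le_of_le (by isBoundedDefault) fun b hb => ?_
  obtain ⟨j, hj⟩ := hb.exists
  refine hj.trans ?_
  have h0 := (hu' j).2.1
  have h1 : u j < 1 := lt_of_le_of_lt ((hu' j).2.2.trans (min_le_right _ _)) (by norm_num)
  have hΦ := lt_rpow_neg_of_log_div_lt (h.pos _) h0 h1 (hu' j).1
  calc ∑ i : S j, Metric.ediam (Metric.closedBall (i : X) (u j)) ^ (s : ℝ)
      ≤ ∑ i : S j, ENNReal.ofReal ((2 * u j) ^ (s : ℝ)) := by
        refine Finset.sum_le_sum fun i _ => ?_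
        rw [← ENNReal.ofReal_rpow_of_nonneg (by linarith) s.coe_nonneg]
        exact ENNReal.rpow_le_rpow (hdiam j i) s.coe_nonneg
    _ = ENNReal.ofReal ((S j).card * (2 * u j) ^ (s : ℝ)) := by
        rw [Finset.sum_const, nsmul_eq_mul, ENNReal.ofReal_mul (by positivity)]
        simp
    _ ≤ ENNReal.ofReal (2 ^ (s : ℝ)) := by
        apply ENNReal.ofReal_le_ofReal
        rw [Real.mul_rpow (by norm_num) h0.le, mul_left_comm]
        have : ((S j).card : ℝ) * u j ^ (s : ℝ) ≤ 1 := by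
          calc ((S j).card : ℝ) * u j ^ (s : ℝ) ≤ u j ^ (-(s : ℝ)) * u j ^ (s : ℝ) := by
                gcongr
                exact (hSc j).trans hΦ.le
            _ = 1 := by rw [← Real.rpow_add h0]; simp
        exact mul_le_of_le_one_right (by positivity) this

lemma le_dimH [BorelSpace X] (h : IsScaleMeasure E μ Φ M r₀) {s : NNReal} (hs0 : 0 < s)
    (hs : (s : ℝ) <
      liminf (fun r => Real.log (Φ r) / -Real.log r) (nhdsWithin (0 : ℝ) (Set.Ioi 0))) :
    s ≤ dimH E := by
  have := h.prob
  have hM := h.M_pos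
  obtain ⟨δ, hδ, hball⟩ : ∃ δ : ℝ, 0 < δ ∧ ∀ r, 0 < r → r ≤ δ → ∀ x,
      μ.real (Metric.closedBall x r) ≤ M * r ^ (s : ℝ) := by
    apply exists_forall_of_eventually_nhdsGT
    filter_upwards [eventually_lt_of_lt_liminf hs h.bounded_ge, eventually_pos_and_le h.r₀_pos,
      eventually_pos_and_le (by norm_num : (0 : ℝ) < 1 / 2)] with r h1 h2 h3 x
    refine (h.measure_le x r h2.1 h2.2).trans ?_
    have := rpow_neg_lt_of_lt_log_div (h.pos r) h2.1 (by linarith) h1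
    gcongr
    rw [inv_le_comm₀ (h.pos r) (by have := h2.1; positivity), ← Real.rpow_neg h2.1.le]
    exact this.le
  have hle : ENNReal.ofReal M⁻¹ • μ ≤ Measure.hausdorffMeasure (s : ℝ) := by
    refine Measure.le_hausdorffMeasure _ _ (ENNReal.ofReal δ) (by simpa using hδ) fun A hA => ?_
    rcases A.eq_empty_or_nonempty with rfl | ⟨x, hx⟩
    · simp
    have hfin : Metric.ediam A ≠ ⊤ := ne_top_of_le_ne_top ENNReal.ofReal_ne_top hA
    have hdiam : Metric.diam A ≤ δ := by
      rw [Metric.diam]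
      exact ENNReal.toReal_le_of_le_ofReal hδ.le hA
    have hsub : ∀ r, Metric.diam A ≤ r → A ⊆ Metric.closedBall x r := fun r hr y hy =>
      (Metric.dist_le_diam_of_mem' hfin hy hx).trans hr
    have hmass : ∀ r, 0 < r → r ≤ δ → Metric.diam A ≤ r →
        (ENNReal.ofReal M⁻¹ • μ) A ≤ ENNReal.ofReal (r ^ (s : ℝ)) := by
      intro r h0 h1 h2
      calc (ENNReal.ofReal M⁻¹ • μ) A = ENNReal.ofReal M⁻¹ * μ A := by simp
        _ ≤ ENNReal.ofReal M⁻¹ * ENNReal.ofReal (M * r ^ (s : ℝ)) := by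
            gcongr
            refine (measure_mono (hsub r h2)).trans ?_
            rw [← ofReal_measureReal]
            exact ENNReal.ofReal_le_ofReal (hball r h0 h1 x)
        _ = ENNReal.ofReal (r ^ (s : ℝ)) := by
            rw [← ENNReal.ofReal_mul (by positivity)]
            field_simp
    rcases (Metric.diam_nonneg (s := A)).eq_or_lt with h0 | h0
    · have : Tendsto (fun r : ℝ => ENNReal.ofReal (r ^ (s : ℝ)))
          (nhdsWithin (0 : ℝ) (Set.Ioi 0)) (nhds 0) := by
        have hc : ContinuousAt (fun r : ℝ => r ^ (s : ℝ)) 0 :=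
          Real.continuousAt_rpow_const _ _ (Or.inr s.2)
        have := (ENNReal.tendsto_ofReal hc.tendsto).mono_left
          (nhdsWithin_le_nhds (s := Set.Ioi (0 : ℝ)))
        simpa [Real.zero_rpow (NNReal.coe_ne_zero.2 hs0.ne')] using this
      refine (ge_of_tendsto this ?_).trans zero_le
      filter_upwards [eventually_pos_and_le hδ] with r hr
      exact hmass r hr.1 hr.2 (h0 ▸ hr.1.le)
    · refine (hmass _ h0 hdiam le_rfl).trans_eq ?_
      rw [← ENNReal.ofReal_rpow_of_pos h0, Metric.diam, ENNReal.ofReal_toReal hfin]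
  apply le_dimH_of_hausdorffMeasure_ne_zero
  have := hle E
  simp only [Measure.smul_apply, h.full, smul_eq_mul, mul_one] at this
  exact (lt_of_lt_of_le (by simpa using hM) this).ne'

theorem dimH_eq [BorelSpace X] (h : IsScaleMeasure E μ Φ M r₀) :
    dimH E = ENNReal.ofReal
      (liminf (fun r => Real.log (Φ r) / -Real.log r) (nhdsWithin (0 : ℝ) (Set.Ioi 0))) := by
  apply le_antisymm
  · refine le_of_forall_gt_imp_ge_of_dense fun a ha => ?_
    obtain ⟨s, hs, hsa⟩ := ENNReal.lt_iff_exists_nnreal_btwn.1 ha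
    refine (h.dimH_le ?_).trans hsa.le
    rw [← ENNReal.ofReal_coe_nnreal] at hs
    exact (ENNReal.ofReal_lt_ofReal_iff'.1 hs).1
  · refine ENNReal.le_of_forall_nnreal_lt fun s hs => ?_
    rcases eq_zero_or_pos s with rfl | hs0
    · simp
    refine h.le_dimH hs0 ?_
    rw [← ENNReal.ofReal_coe_nnreal] at hs
    exact (ENNReal.ofReal_lt_ofReal_iff'.1 hs).1

lemma packPre_eq_zero [BorelSpace X] (h : IsScaleMeasure E μ Φ M r₀) {s : ℝ}
    (hs : limsup (fun r => Real.log (Φ r) / -Real.log r) (nhdsWithin (0 : ℝ) (Set.Ioi 0)) < s) :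
    packPre E s = 0 := by
  have := h.prob
  obtain ⟨t, ht, hts⟩ := exists_between hs
  obtain ⟨δ₀, hδ₀, hball⟩ : ∃ δ : ℝ, 0 < δ ∧ ∀ r, 0 < r → r ≤ δ → ∀ x ∈ E,
      r ^ t ≤ μ.real (Metric.closedBall x r) := by
    apply exists_forall_of_eventually_nhdsGT
    filter_upwards [eventually_lt_of_limsup_lt ht h.bounded, eventually_pos_and_le h.r₀_pos,
      eventually_pos_and_le (by norm_num : (0 : ℝ) < 1 / 2)] with r h1 h2 h3 x hx
    refine le_trans ?_ (h.le_measure x hx r h2.1 h2.2)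
    have := lt_rpow_neg_of_log_div_lt (h.pos r) h2.1 (by linarith) h1
    rw [le_inv_comm₀ (by have := h2.1; positivity) (h.pos r), ← Real.rpow_neg h2.1.le]
    exact this.le
  have hbound : ∀ δ, 0 < δ → δ ≤ δ₀ → packPre E s ≤ ENNReal.ofReal (δ ^ (s - t)) := by
    intro δ h0 h1
    refine (iInf₂_le δ h0).trans ?_
    refine iSup_le fun m => iSup_le fun x => iSup_le fun ρ => iSup_le fun hx => iSup_le fun hρ =>
      iSup_le fun hdisj => ?_
    rw [← ENNReal.ofReal_sum_of_nonneg fun i _ => Real.rpow_nonneg (hρ i).1.le _]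
    apply ENNReal.ofReal_le_ofReal
    calc ∑ i, ρ i ^ s ≤ ∑ i, δ ^ (s - t) * μ.real (Metric.closedBall (x i) (ρ i)) := by
          refine Finset.sum_le_sum fun i _ => ?_
          have hi := hρ i
          calc ρ i ^ s = ρ i ^ (s - t) * ρ i ^ t := by rw [← Real.rpow_add hi.1]; simp
            _ ≤ _ := by
              have h1 := hball (ρ i) hi.1 (hi.2.trans h1) (x i) (hx i)
              have h2 := Real.rpow_le_rpow hi.1.le hi.2 (sub_pos.2 hts).le
              have := Real.rpow_nonneg hi.1.le t
              gcongr
      _ = δ ^ (s - t) * μ.real (⋃ i ∈ Finset.univ, Metric.closedBall (x i) (ρ i)) := by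
          rw [measureReal_biUnion_finset, Finset.mul_sum]
          · intro i _ j _ hij
            exact hdisj i j hij
          · exact fun i _ => measurableSet_closedBall
      _ ≤ δ ^ (s - t) := mul_le_of_le_one_right (by positivity) measureReal_le_one
  have hlim : Tendsto (fun δ : ℝ => ENNReal.ofReal (δ ^ (s - t)))
      (nhdsWithin (0 : ℝ) (Set.Ioi 0)) (nhds 0) := by
    have hc : ContinuousAt (fun r : ℝ => r ^ (s - t)) 0 :=
      Real.continuousAt_rpow_const _ _ (Or.inr (sub_pos.2 hts).le)
    have := (ENNReal.tendsto_ofReal hc.tendsto).mono_left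
      (nhdsWithin_le_nhds (s := Set.Ioi (0 : ℝ)))
    simpa [Real.zero_rpow (sub_pos.2 hts).ne'] using this
  refine le_antisymm (ge_of_tendsto hlim ?_) zero_le
  filter_upwards [eventually_pos_and_le hδ₀] with δ hδ
  exact hbound δ hδ.1 hδ.2

lemma mul_measure_le_packPre (h : IsScaleMeasure E μ Φ M r₀) {s : ℝ}
    (hs : s < limsup (fun r => Real.log (Φ r) / -Real.log r) (nhdsWithin (0 : ℝ) (Set.Ioi 0)))
    (A : Set X) : ENNReal.ofReal ((2 ^ s)⁻¹ * M⁻¹) * μ A ≤ packPre A s := by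
  have := h.prob
  have hM := h.M_pos
  refine le_iInf₂ fun δ hδ => ?_
  obtain ⟨r, hr, hr0, hrδ⟩ :=
    ((frequently_lt_of_lt_limsup h.bounded_ge.isCoboundedUnder_le hs).and_eventually
      (eventually_pos_and_le (lt_min hδ
        (lt_min h.r₀_pos (by norm_num : (0 : ℝ) < 1 / 2))))).exists
  rw [le_min_iff, le_min_iff] at hrδ
  have hΦ := rpow_neg_lt_of_lt_log_div (h.pos r) hr0 (by linarith) hr
  have hball : ∀ x, μ.real (Metric.closedBall x r) ≤ M * r ^ s := by
    intro x
    refine (h.measure_le x r hr0 hrδ.2.1).trans ?_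
    gcongr
    rw [inv_le_comm₀ (h.pos r) (by positivity), ← Real.rpow_neg hr0.le]
    exact hΦ.le
  have hq : 0 < M * r ^ s := by positivity
  obtain ⟨m, hm⟩ := exists_nat_ge (M * r ^ s)⁻¹
  obtain ⟨S, hSA, hsep, hS⟩ := exists_separated A hr0.le m
  have hμA : μ A ≤ ENNReal.ofReal (S.card * (M * r ^ s)) := by
    rcases hS with hS | hS
    · refine prob_le_one.trans ?_
      rw [← ENNReal.ofReal_one, hS]
      apply ENNReal.ofReal_le_ofReal
      rwa [inv_le_iff_one_le_mul₀ hq] at hm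
    · refine (measure_mono hS).trans ?_
      rw [← ofReal_measureReal (measure_ne_top _ _)]
      apply ENNReal.ofReal_le_ofReal
      refine (measureReal_biUnion_finset_le _ _).trans ?_
      refine (Finset.sum_le_sum fun x _ => hball x).trans_eq ?_
      rw [Finset.sum_const, nsmul_eq_mul]
  refine le_iSup_of_le S.card <| le_iSup_of_le (fun i => (S.equivFin.symm i : X)) <|
    le_iSup_of_le (fun _ => r / 2) <| le_iSup_of_le (fun i => hSA (S.equivFin.symm i).2) <|
    le_iSup_of_le (fun _ => ⟨half_pos hr0, by linarith⟩) <| le_iSup_of_le ?_ ?_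
  · intro i j hij
    apply Metric.closedBall_disjoint_closedBall
    rw [add_halves]
    refine hsep _ (S.equivFin.symm i).2 _ (S.equivFin.symm j).2 fun he => hij ?_
    exact S.equivFin.symm.injective (Subtype.ext he)
  · rw [Finset.sum_const, Finset.card_univ, Fintype.card_fin, nsmul_eq_mul]
    calc _ ≤ ENNReal.ofReal ((2 ^ s)⁻¹ * M⁻¹) * ENNReal.ofReal (S.card * (M * r ^ s)) := by
          gcongr
      _ = S.card * ENNReal.ofReal ((r / 2) ^ s) := by
          rw [← ENNReal.ofReal_mul (by positivity), Real.div_rpow hr0.le (by norm_num),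
            ← ENNReal.ofReal_natCast, ← ENNReal.ofReal_mul (by positivity)]
          congr 1
          field_simp

theorem packDim_eq [BorelSpace X] (h : IsScaleMeasure E μ Φ M r₀) :
    packDim E =
      limsup (fun r => Real.log (Φ r) / -Real.log r) (nhdsWithin (0 : ℝ) (Set.Ioi 0)) := by
  have hM := h.M_pos
  have hmem : ∀ s : ℝ,
      limsup (fun r => Real.log (Φ r) / -Real.log r) (nhdsWithin (0 : ℝ) (Set.Ioi 0)) < s →
      s ∈ {s : ℝ | 0 ≤ s ∧ packMeasure E s = 0} := by
    refine fun s hs => ⟨h.limsup_nonneg.trans hs.le, le_antisymm ?_ zero_le⟩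
    refine (iInf₂_le (fun _ => E) (Set.subset_iUnion (fun _ : ℕ => E) 0)).trans ?_
    simp [h.packPre_eq_zero hs]
  refine csInf_eq_of_forall_ge_of_forall_gt_exists_lt ⟨_, hmem _ (lt_add_one _)⟩ ?_ ?_
  · rintro s ⟨-, hs⟩
    by_contra! hlt
    have : ENNReal.ofReal ((2 ^ s)⁻¹ * M⁻¹) ≤ packMeasure E s := by
      refine le_iInf₂ fun F hF => ?_
      calc ENNReal.ofReal ((2 ^ s)⁻¹ * M⁻¹) = ENNReal.ofReal ((2 ^ s)⁻¹ * M⁻¹) * μ E := by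
            rw [h.full, mul_one]
        _ ≤ ENNReal.ofReal ((2 ^ s)⁻¹ * M⁻¹) * ∑' m, μ (F m) := by
            gcongr
            exact (measure_mono hF).trans (measure_iUnion_le F)
        _ = ∑' m, ENNReal.ofReal ((2 ^ s)⁻¹ * M⁻¹) * μ (F m) := ENNReal.tsum_mul_left.symm
        _ ≤ _ := ENNReal.tsum_le_tsum fun m => h.mul_measure_le_packPre hlt _
    rw [hs] at this
    simp only [nonpos_iff_eq_zero, ENNReal.ofReal_eq_zero] at this
    exact absurd this (not_le.2 (by positivity))
  · intro w hw
    obtain ⟨s, hs, hsw⟩ := exists_between hw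
    exact ⟨s, hmem s hs, hsw⟩

lemma coverNum_le (h : IsScaleMeasure E μ Φ M r₀) {r : ℝ} (hr : 0 < r) (hr₀ : r ≤ r₀) :
    (coverNum E r : ℝ) ≤ Φ r := by
  obtain ⟨s, hs, hE⟩ := h.cover r hr hr₀
  refine le_trans ?_ hs
  exact Nat.cast_le.2 (Nat.sInf_le ⟨s, rfl, hE⟩)

lemma le_coverNum (h : IsScaleMeasure E μ Φ M r₀) {r : ℝ} (hr : 0 < r) (hr₀ : r ≤ r₀) :
    Φ r ≤ M * coverNum E r := by
  have := h.prob
  obtain ⟨s₀, -, hE₀⟩ := h.cover r hr hr₀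
  obtain ⟨s, hs, hE⟩ : ∃ s : Finset X, s.card = coverNum E r ∧
      E ⊆ ⋃ x ∈ s, Metric.closedBall x r :=
    Nat.sInf_mem (s := {m : ℕ | ∃ s : Finset X, s.card = m ∧ E ⊆ ⋃ x ∈ s, Metric.closedBall x r})
      ⟨_, s₀, rfl, hE₀⟩
  have hμ : μ.real E = 1 := by simp [measureReal_def, h.full]
  have key : (1 : ℝ) ≤ coverNum E r * (M * (Φ r)⁻¹) := by
    calc (1 : ℝ) = μ.real E := hμ.symm
      _ ≤ μ.real (⋃ x ∈ s, Metric.closedBall x r) := measureReal_mono hE (measure_ne_top _ _)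
      _ ≤ ∑ x ∈ s, μ.real (Metric.closedBall x r) := measureReal_biUnion_finset_le _ _
      _ ≤ ∑ x ∈ s, M * (Φ r)⁻¹ := Finset.sum_le_sum fun x _ => h.measure_le x r hr hr₀
      _ = _ := by rw [Finset.sum_const, nsmul_eq_mul, hs]
  rw [← mul_assoc, ← div_eq_mul_inv, le_div_iff₀ (h.pos r)] at key
  linarith

lemma tendsto_log_coverNum_sub (h : IsScaleMeasure E μ Φ M r₀) :
    Tendsto (fun r => Real.log (coverNum E r) / -Real.log r - Real.log (Φ r) / -Real.log r)
      (nhdsWithin (0 : ℝ) (Set.Ioi 0)) (nhds 0) := by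
  have hlog : Tendsto (fun r : ℝ => -Real.log r) (nhdsWithin (0 : ℝ) (Set.Ioi 0)) atTop :=
    tendsto_neg_atBot_atTop.comp Real.tendsto_log_nhdsGT_zero
  refine squeeze_zero_norm' ?_ (hlog.const_div_atTop (|Real.log M|))
  filter_upwards [eventually_pos_and_le h.r₀_pos,
    eventually_pos_and_le (by norm_num : (0 : ℝ) < 1 / 2)] with r h1 h2
  have hneg : 0 < -Real.log r := neg_pos.2 (Real.log_neg h2.1 (by linarith))
  have hup := h.coverNum_le h1.1 h1.2
  have hlow := h.le_coverNum h1.1 h1.2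
  have hpos : (0 : ℝ) < coverNum E r := by
    have : 0 < M * coverNum E r := (h.pos r).trans_le hlow
    exact (mul_pos_iff_of_pos_left h.M_pos).1 this
  have l1 := Real.log_le_log hpos hup
  have l2 := Real.log_le_log (h.pos r) hlow
  rw [Real.log_mul h.M_pos.ne' hpos.ne'] at l2
  rw [← sub_div, Real.norm_eq_abs, abs_div, abs_of_pos hneg]
  refine div_le_div_of_nonneg_right ?_ hneg.le
  rw [abs_le]
  have := le_abs_self (Real.log M)
  have := abs_nonneg (Real.log M)
  constructor <;> linarith

theorem lowerBoxDim_eq (h : IsScaleMeasure E μ Φ M r₀) :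
    lowerBoxDim E =
      liminf (fun r => Real.log (Φ r) / -Real.log r) (nhdsWithin (0 : ℝ) (Set.Ioi 0)) :=
  liminf_eq_of_tendsto_sub h.tendsto_log_coverNum_sub h.bounded h.bounded_ge

theorem upperBoxDim_eq (h : IsScaleMeasure E μ Φ M r₀) :
    upperBoxDim E =
      limsup (fun r => Real.log (Φ r) / -Real.log r) (nhdsWithin (0 : ℝ) (Set.Ioi 0)) :=
  limsup_eq_of_tendsto_sub h.tendsto_log_coverNum_sub h.bounded h.bounded_ge

end IsScaleMeasure

section Scales

variable {n : ℕ → ℕ} {c : ℕ → ℝ} {c₀ D : ℝ}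

lemma prodN_pos (hn : ∀ k, 2 ≤ n k) (k : ℕ) : 0 < prodN n k :=
  Finset.prod_pos fun i _ => two_pos.trans_le (hn i)

lemma two_pow_le_prodN (hn : ∀ k, 2 ≤ n k) (k : ℕ) : 2 ^ k ≤ prodN n k := by
  simpa [prodN] using Finset.prod_le_prod' (s := Finset.range k) fun i _ => hn i

lemma prodC_succ (c : ℕ → ℝ) (k : ℕ) : prodC c (k + 1) = prodC c k * c k :=
  Finset.prod_range_succ _ _

lemma prodC_zero (c : ℕ → ℝ) : prodC c 0 = 1 := by simp [prodC]

lemma prodC_pos (hc : ∀ k, 0 < c k) (k : ℕ) : 0 < prodC c k :=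
  Finset.prod_pos fun i _ => hc i

lemma prodC_strictAnti (hc : ∀ k, 0 < c k) (hc1 : ∀ k, c k < 1) : StrictAnti (prodC c) :=
  strictAnti_nat_of_succ_lt fun k => by
    rw [prodC_succ]
    exact mul_lt_of_lt_one_right (prodC_pos hc k) (hc1 k)

lemma prodC_levelOf_lt (hlim : Tendsto (prodC c) atTop (nhds 0)) {r : ℝ} (hr : 0 < r) :
    prodC c (levelOf c D r) * D < r := by
  have h0 : Tendsto (fun k => prodC c k * D) atTop (nhds 0) := by
    simpa using hlim.mul_const D
  exact Nat.sInf_mem (s := {k : ℕ | prodC c k * D < r}) (h0.eventually (gt_mem_nhds hr)).exists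

lemma le_prodC_levelOf (hc₀ : 0 < c₀) (hc : ∀ k, c₀ ≤ c k)
    (hlim : Tendsto (prodC c) atTop (nhds 0)) {r : ℝ} (hr : 0 < r) (hrD : r ≤ D) :
    c₀ * r ≤ prodC c (levelOf c D r) * D := by
  have hlt := prodC_levelOf_lt (D := D) hlim hr
  obtain ⟨k, hk⟩ : ∃ k, levelOf c D r = k + 1 := by
    refine Nat.exists_eq_succ_of_ne_zero fun h0 => ?_
    rw [h0, prodC_zero] at hlt
    linarith
  have hle : r ≤ prodC c k * D := by
    by_contra! h
    have : levelOf c D r ≤ k := Nat.sInf_le (s := {k : ℕ | prodC c k * D < r}) h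
    omega
  have hpos : 0 < prodC c k * D := hr.trans_le hle
  rw [hk, prodC_succ, mul_right_comm, mul_comm c₀]
  exact mul_le_mul hle (hc k) hc₀.le hpos.le

lemma levelOf_prodC (hc : ∀ k, 0 < c k) (hc1 : ∀ k, c k < 1) (hD : 0 < D) (j : ℕ) :
    levelOf c D (prodC c j * D) = j + 1 := by
  have : {k : ℕ | prodC c k * D < prodC c j * D} = Set.Ici (j + 1) := by
    ext k
    simp [mul_lt_mul_iff_left₀ hD, (prodC_strictAnti hc hc1).lt_iff_gt]
  rw [levelOf, this, csInf_Ici]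

lemma tendsto_levelOf (hc : ∀ k, 0 < c k) (hc1 : ∀ k, c k < 1) (hD : 0 < D)
    (hlim : Tendsto (prodC c) atTop (nhds 0)) :
    Tendsto (levelOf c D) (nhdsWithin (0 : ℝ) (Set.Ioi 0)) atTop := by
  refine tendsto_atTop.2 fun j => ?_
  filter_upwards [eventually_pos_and_le (mul_pos (prodC_pos hc j) hD)] with r hr
  have h1 := (prodC_levelOf_lt (D := D) hlim hr.1).trans_le hr.2
  rw [mul_lt_mul_iff_left₀ hD, (prodC_strictAnti hc hc1).lt_iff_gt] at h1
  exact le_of_lt h1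

lemma map_levelOf (hc : ∀ k, 0 < c k) (hc1 : ∀ k, c k < 1) (hD : 0 < D)
    (hlim : Tendsto (prodC c) atTop (nhds 0)) :
    map (levelOf c D) (nhdsWithin (0 : ℝ) (Set.Ioi 0)) = atTop := by
  refine le_antisymm (tendsto_levelOf hc hc1 hD hlim) fun S hS => ?_
  obtain ⟨δ, hδ, hδS⟩ := exists_forall_of_eventually_nhdsGT (mem_map.1 hS)
  have h0 : Tendsto (fun k => prodC c k * D) atTop (nhds 0) := by
    simpa using hlim.mul_const D
  obtain ⟨m, hm⟩ := eventually_atTop.1 (h0.eventually (ge_mem_nhds hδ))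
  refine mem_atTop_sets.2 ⟨m + 1, fun i hi => ?_⟩
  obtain ⟨j, rfl⟩ := Nat.exists_eq_succ_of_ne_zero (by omega : i ≠ 0)
  have := hδS _ (mul_pos (prodC_pos hc j) hD) (hm j (by omega))
  rwa [levelOf_prodC hc hc1 hD] at this

lemma moranRatio_nonneg (n : ℕ → ℕ) (hc : ∀ k, 0 < c k) (hc1 : ∀ k, c k < 1) (k : ℕ) :
    0 ≤ Real.log (prodN n k : ℝ) / -Real.log (prodC c k) := by
  refine div_nonneg (Real.log_natCast_nonneg _) (neg_nonneg.2 (Real.log_nonpos ?_ ?_))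
  · exact (prodC_pos hc k).le
  · exact prodC_zero c ▸ (prodC_strictAnti hc hc1).antitone (Nat.zero_le k)

lemma tendsto_log_Phi_sub (n : ℕ → ℕ) (hc₀ : 0 < c₀) (hc : ∀ k, c₀ ≤ c k)
    (hc1 : ∀ k, c k < 1) (hD : 0 < D) (hlim : Tendsto (prodC c) atTop (nhds 0)) {P : ℝ}
    (hP : ∀ᶠ k in atTop, Real.log (prodN n k : ℝ) / -Real.log (prodC c k) ≤ P) :
    Tendsto (fun r => Real.log (Phi n c D r : ℝ) / -Real.log r -
        Real.log (prodN n (levelOf c D r) : ℝ) / -Real.log (prodC c (levelOf c D r)))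
      (nhdsWithin (0 : ℝ) (Set.Ioi 0)) (nhds 0) := by
  have hcpos : ∀ k, 0 < c k := fun k => hc₀.trans_le (hc k)
  have hlev := tendsto_levelOf hcpos hc1 hD hlim
  have hlog : Tendsto (fun r : ℝ => -Real.log r) (nhdsWithin (0 : ℝ) (Set.Ioi 0)) atTop :=
    tendsto_neg_atBot_atTop.comp Real.tendsto_log_nhdsGT_zero
  refine squeeze_zero_norm' ?_ (hlog.const_div_atTop (P * (|Real.log D| + |Real.log c₀|)))
  filter_upwards [eventually_pos_and_le hD, eventually_pos_and_le (by norm_num : (0 : ℝ) < 1 / 2),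
    hlev.eventually hP, hlev.eventually (eventually_ge_atTop 1)] with r h1 h2 h3 h4
  have hup := prodC_levelOf_lt (D := D) hlim h1.1
  have hlow := le_prodC_levelOf hc₀ hc hlim h1.1 h1.2
  have hnn := moranRatio_nonneg n hcpos hc1 (levelOf c D r)
  rw [Phi]
  set k := levelOf c D r
  have hCk := prodC_pos hcpos k
  have hx : 0 < -Real.log r := neg_pos.2 (Real.log_neg h2.1 (by linarith))
  have hy : 0 < -Real.log (prodC c k) := by
    refine neg_pos.2 (Real.log_neg hCk ?_)
    exact prodC_zero c ▸ prodC_strictAnti hcpos hc1 (by omega : 0 < k)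
  have l1 := Real.log_lt_log (by positivity) hup
  have l2 := Real.log_le_log (mul_pos hc₀ h1.1) hlow
  rw [Real.log_mul hCk.ne' hD.ne'] at l1 l2
  rw [Real.log_mul hc₀.ne' h1.1.ne'] at l2
  have heq : Real.log (prodN n k : ℝ) / -Real.log r - Real.log (prodN n k : ℝ) /
      -Real.log (prodC c k) = Real.log (prodN n k : ℝ) / -Real.log (prodC c k) *
        (-Real.log (prodC c k) - -Real.log r) / -Real.log r := by
    have hx' := (neg_pos.1 hx).ne
    have hy' := (neg_pos.1 hy).ne
    field_simp
  rw [heq, Real.norm_eq_abs, abs_div, abs_mul, abs_of_pos hx, abs_of_nonneg hnn]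
  refine div_le_div_of_nonneg_right ?_ hx.le
  refine mul_le_mul h3 ?_ (abs_nonneg _) (hnn.trans h3)
  have a1 := le_abs_self (Real.log D)
  have a2 := neg_abs_le (Real.log D)
  have a3 := neg_abs_le (Real.log c₀)
  have a4 := abs_nonneg (Real.log c₀)
  rw [abs_le]
  constructor <;> linarith

end Scales

/-- Words of length `k` whose `i`-th letter is less than `n i`. -/
abbrev MoranWord (n : ℕ → ℕ) (k : ℕ) : Type := ∀ i : Fin k, Fin (n i)

namespace MoranWord

variable {n : ℕ → ℕ} {k : ℕ}

/-- The list of letters of a word. -/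
def toList (u : MoranWord n k) : List ℕ := List.ofFn fun i => (u i : ℕ)

/-- A word with its last letter removed. -/
def dropLast (u : MoranWord n (k + 1)) : MoranWord n k := fun i => u i.castSucc

/-- The initial word of length `k` of an infinite word. -/
def ofSeq (ω : ∀ i, Fin (n i)) (k : ℕ) : MoranWord n k := fun i => ω i

@[simp] lemma length_toList (u : MoranWord n k) : u.toList.length = k := by simp [toList]

lemma admWord_toList (u : MoranWord n k) : AdmWord n u.toList := by
  intro i
  have hi : i.val < k := by simpa using i.2
  have hget : u.toList.get i = u ⟨i.val, hi⟩ :=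
    List.getElem_ofFn (by simpa [toList] using i.2)
  exact hget ▸ (u ⟨i.val, hi⟩).2

lemma toList_succ (u : MoranWord n (k + 1)) :
    u.toList = u.dropLast.toList ++ [(u (Fin.last k) : ℕ)] := by
  rw [toList, List.ofFn_succ', List.concat_eq_append]
  rfl

lemma exists_toList_eq {w : List ℕ} (hk : w.length = k) (hw : AdmWord n w) :
    ∃ u : MoranWord n k, u.toList = w := by
  subst hk
  exact ⟨fun i => ⟨w.get i, hw i⟩, by simp [toList]⟩

lemma card_eq (n : ℕ → ℕ) (k : ℕ) : Fintype.card (MoranWord n k) = prodN n k := by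
  rw [Fintype.card_pi, prodN, ← Fin.prod_univ_eq_prod_range]
  simp

end MoranWord

lemma mem_moranSet_iff {d : ℕ} {n : ℕ → ℕ} {Jw : List ℕ → Set (EuclideanSpace ℝ (Fin d))}
    {x : EuclideanSpace ℝ (Fin d)} :
    x ∈ moranSet n Jw ↔ ∀ k, ∃ u : MoranWord n k, x ∈ Jw u.toList := by
  simp only [moranSet, Set.mem_iInter, Set.mem_iUnion, exists_prop]
  refine forall_congr' fun k => ⟨?_, ?_⟩
  · rintro ⟨w, ⟨hk, hw⟩, hx⟩
    obtain ⟨u, rfl⟩ := MoranWord.exists_toList_eq hk hw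
    exact ⟨u, hx⟩
  · rintro ⟨u, hx⟩
    exact ⟨_, ⟨u.length_toList, u.admWord_toList⟩, hx⟩

/-- A map of a Euclidean space to itself scaling all distances by `ρ > 0` maps balls onto balls. -/
lemma image_ball_of_dist_eq {d : ℕ} {T : EuclideanSpace ℝ (Fin d) → EuclideanSpace ℝ (Fin d)}
    {ρ : ℝ} (hρ : 0 < ρ) (hT : ∀ x y, dist (T x) (T y) = ρ * dist x y)
    (p : EuclideanSpace ℝ (Fin d)) (a : ℝ) :
    T '' Metric.ball p a = Metric.ball (T p) (ρ * a) := by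
  have hiso : Isometry fun x => ρ⁻¹ • T x := by
    refine Isometry.of_dist_eq fun x y => ?_
    rw [dist_smul₀, hT, Real.norm_eq_abs, abs_of_pos (inv_pos.2 hρ),
      inv_mul_cancel_left₀ hρ.ne']
  have hsurj : Function.Surjective T := by
    intro y
    obtain ⟨x, hx⟩ := (hiso.affineIsometryOfStrictConvexSpace.toAffineIsometryEquiv
      rfl).surjective (ρ⁻¹ • y)
    refine ⟨x, ?_⟩
    have hx' : ρ⁻¹ • T x = ρ⁻¹ • y := hx
    exact smul_right_injective _ (inv_ne_zero hρ.ne') hx'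
  ext y
  obtain ⟨x, rfl⟩ := hsurj y
  have hinj : Function.Injective T := by
    intro x x' hxx
    have := hT x x'
    rw [hxx, dist_self, eq_comm, mul_eq_zero] at this
    exact dist_eq_zero.1 (this.resolve_left hρ.ne')
  rw [hinj.mem_set_image, Metric.mem_ball, Metric.mem_ball, hT, mul_lt_mul_iff_right₀ hρ]

namespace IsMoranSystem

variable {d : ℕ} {J : Set (EuclideanSpace ℝ (Fin d))} {n : ℕ → ℕ} {c : ℕ → ℝ}
  {Jw : List ℕ → Set (EuclideanSpace ℝ (Fin d))}

lemma subset_dropLast (h : IsMoranSystem J n c Jw) {k : ℕ} (u : MoranWord n (k + 1)) :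
    Jw u.toList ⊆ Jw u.dropLast.toList := by
  rw [u.toList_succ]
  exact h.subset _ u.dropLast.admWord_toList _ (by simp)

lemma exists_similarity (h : IsMoranSystem J n c Jw) {k : ℕ} (u : MoranWord n k) :
    ∃ T : EuclideanSpace ℝ (Fin d) → EuclideanSpace ℝ (Fin d),
      (∀ x y, dist (T x) (T y) = prodC c k * dist x y) ∧ Jw u.toList = T '' J := by
  induction k with
  | zero => exact ⟨id, by simp [prodC_zero], by simp [MoranWord.toList, h.root]⟩
  | succ k ih =>
    obtain ⟨T, hT, hJT⟩ := ih u.dropLast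
    obtain ⟨S, hS, hJS⟩ := h.similar _ u.dropLast.admWord_toList (u (Fin.last k)) (by simp)
    rw [MoranWord.length_toList] at hS
    refine ⟨S ∘ T, fun x y => ?_, ?_⟩
    · rw [Function.comp, Function.comp, hS, hT, prodC_succ]
      ring
    · rw [u.toList_succ, hJS, hJT, Set.image_comp]

lemma disjoint_interior (h : IsMoranSystem J n c Jw) {k : ℕ} {u v : MoranWord n k}
    (huv : u ≠ v) : Disjoint (interior (Jw u.toList)) (interior (Jw v.toList)) := by
  induction k with
  | zero => exact absurd (Subsingleton.elim u v) huv
  | succ k ih =>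
    by_cases hi : u.dropLast = v.dropLast
    · have hl : u (Fin.last k) ≠ v (Fin.last k) := by
        intro hl
        refine huv (funext fun i => ?_)
        induction i using Fin.lastCases with
        | last => exact hl
        | cast i => exact congrFun hi i
      rw [u.toList_succ, v.toList_succ, hi]
      exact h.disj_int _ v.dropLast.admWord_toList _ (by simp) _ (by simp)
        fun he => hl (Fin.ext he)
    · exact (ih hi).mono (interior_mono (h.subset_dropLast u)) (interior_mono (h.subset_dropLast v))

lemma isCompact_cell (h : IsMoranSystem J n c Jw) {k : ℕ} (u : MoranWord n k) :
    IsCompact (Jw u.toList) := by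
  obtain ⟨T, hT, hJT⟩ := h.exists_similarity u
  rw [hJT]
  have : LipschitzWith (Real.toNNReal (prodC c k)) T :=
    LipschitzWith.of_dist_le_mul fun x y => by
      rw [hT, Real.coe_toNNReal _ (prodC_pos h.c_pos k).le]
  exact h.compact.image this.continuous

lemma nonempty_cell (h : IsMoranSystem J n c Jw) {k : ℕ} (u : MoranWord n k) :
    (Jw u.toList).Nonempty := by
  obtain ⟨T, hT, hJT⟩ := h.exists_similarity u
  rw [hJT]
  exact (h.int_nonempty.mono interior_subset).image T

lemma exists_dist_le (h : IsMoranSystem J n c Jw) :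
    ∃ D : ℝ, 0 < D ∧ ∀ (k : ℕ) (u : MoranWord n k), ∀ x ∈ Jw u.toList, ∀ y ∈ Jw u.toList,
      dist x y ≤ prodC c k * D := by
  refine ⟨Metric.diam J + 1, by have := Metric.diam_nonneg (s := J); linarith, ?_⟩
  intro k u
  obtain ⟨T, hT, hJT⟩ := h.exists_similarity u
  rw [hJT]
  rintro _ ⟨x, hx, rfl⟩ _ ⟨y, hy, rfl⟩
  rw [hT]
  have := prodC_pos h.c_pos k
  gcongr
  have := Metric.dist_le_diam_of_mem h.compact.isBounded hx hy
  linarith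

lemma exists_ball_subset (h : IsMoranSystem J n c Jw) :
    ∃ a : ℝ, 0 < a ∧ ∀ (k : ℕ) (u : MoranWord n k), ∃ p,
      Metric.ball p (prodC c k * a) ⊆ interior (Jw u.toList) := by
  obtain ⟨p, hp⟩ := h.int_nonempty
  obtain ⟨a, ha, hsub⟩ := Metric.mem_nhds_iff.1 (mem_interior_iff_mem_nhds.1 hp)
  refine ⟨a, ha, fun k u => ?_⟩
  obtain ⟨T, hT, hJT⟩ := h.exists_similarity u
  refine ⟨T p, interior_maximal ?_ Metric.isOpen_ball⟩
  rw [hJT, ← image_ball_of_dist_eq (prodC_pos h.c_pos k) hT]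
  exact Set.image_mono hsub

/-- Volume bound for the number of cells of level `k` meeting a given ball. -/
lemma exists_card_mul_le (h : IsMoranSystem J n c Jw) {D : ℝ} (hD : 0 < D)
    (hdist : ∀ (k : ℕ) (u : MoranWord n k), ∀ x ∈ Jw u.toList, ∀ y ∈ Jw u.toList,
      dist x y ≤ prodC c k * D) :
    ∃ a : ℝ, 0 < a ∧ ∀ (k : ℕ) (F : Finset (MoranWord n k)) (x : EuclideanSpace ℝ (Fin d))
      (R : ℝ), 0 ≤ R → (∀ u ∈ F, (Jw u.toList ∩ Metric.closedBall x R).Nonempty) →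
      F.card * (prodC c k * a) ^ d ≤ (R + prodC c k * D) ^ d := by
  obtain ⟨a, ha, hball⟩ := h.exists_ball_subset
  choose p hp using hball
  refine ⟨a, ha, fun k F x R hR hF => ?_⟩
  have hC := prodC_pos h.c_pos k
  let vol : Measure (EuclideanSpace ℝ (Fin d)) := volume
  have hv : 0 < vol.real (Metric.ball (0 : EuclideanSpace ℝ (Fin d)) 1) :=
    ENNReal.toReal_pos (Metric.measure_ball_pos _ _ one_pos).ne' measure_ball_lt_top.ne
  have hsmall : ∀ y : EuclideanSpace ℝ (Fin d), vol.real (Metric.ball y (prodC c k * a)) =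
      (prodC c k * a) ^ d * vol.real (Metric.ball (0 : EuclideanSpace ℝ (Fin d)) 1) := by
    intro y
    have hpos : 0 < prodC c k * a := by positivity
    rw [measureReal_def, Measure.addHaar_ball_of_pos _ _ hpos, ENNReal.toReal_mul,
      ENNReal.toReal_ofReal (by positivity), finrank_euclideanSpace_fin]
    rfl
  have hbig := Measure.addHaar_real_closedBall vol x
    (by positivity : 0 ≤ R + prodC c k * D)
  rw [finrank_euclideanSpace_fin] at hbig
  refine le_of_mul_le_mul_right ?_ hv
  rw [← hbig]
  calc F.card * (prodC c k * a) ^ d * vol.real (Metric.ball 0 1)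
      = ∑ u ∈ F, vol.real (Metric.ball (p k u) (prodC c k * a)) := by
        rw [Finset.sum_congr rfl fun u _ => hsmall _, Finset.sum_const, nsmul_eq_mul, mul_assoc]
    _ = vol.real (⋃ u ∈ F, Metric.ball (p k u) (prodC c k * a)) := by
        rw [measureReal_biUnion_finset]
        · intro u _ v _ huv
          exact (h.disjoint_interior huv).mono (hp k u) (hp k v)
        · exact fun u _ => measurableSet_ball
    _ ≤ vol.real (Metric.closedBall x (R + prodC c k * D)) := by
        refine measureReal_mono ?_ measure_closedBall_lt_top.ne
        refine Set.iUnion₂_subset fun u hu y hy => ?_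
        obtain ⟨z, hz, hzx⟩ := hF u hu
        have h1 := hdist k u y (interior_subset (hp k u hy)) z hz
        have h2 := dist_triangle y z x
        rw [Metric.mem_closedBall] at hzx ⊢
        linarith

lemma prodN_mul_le (h : IsMoranSystem J n c Jw) {D : ℝ} (hD : 0 < D)
    (hdist : ∀ (k : ℕ) (u : MoranWord n k), ∀ x ∈ Jw u.toList, ∀ y ∈ Jw u.toList,
      dist x y ≤ prodC c k * D) :
    ∃ K : ℝ, 0 < K ∧ ∀ k, (prodN n k : ℝ) * prodC c k ^ d ≤ K := by
  obtain ⟨a, ha, hcard⟩ := h.exists_card_mul_le hD hdist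
  refine ⟨(2 * D / a) ^ d, by positivity, fun k => ?_⟩
  obtain ⟨x, hx⟩ := h.int_nonempty.mono interior_subset
  have hC := prodC_pos h.c_pos k
  have hC1 : prodC c k ≤ 1 :=
    prodC_zero c ▸ (prodC_strictAnti h.c_pos h.c_lt_one).antitone (Nat.zero_le k)
  have hroot : ∀ {j : ℕ} (u : MoranWord n j), Jw u.toList ⊆ J := by
    intro j
    induction j with
    | zero => intro u; simp [MoranWord.toList, h.root]
    | succ j ih => exact fun u => (h.subset_dropLast u).trans (ih _)
  have hdJ : ∀ y ∈ J, dist y x ≤ D := by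
    intro y hy
    have := hdist 0 (fun i => i.elim0) y (by simpa [MoranWord.toList, h.root] using hy) x
      (by simpa [MoranWord.toList, h.root] using hx)
    simpa [prodC_zero] using this
  have key := hcard k Finset.univ x D hD.le fun u _ => by
    obtain ⟨y, hy⟩ := h.nonempty_cell u
    exact ⟨y, hy, hdJ y (hroot u hy)⟩
  rw [Finset.card_univ, MoranWord.card_eq, mul_pow, ← mul_assoc] at key
  rw [div_pow, le_div_iff₀ (by positivity)]
  refine key.trans ?_
  gcongr
  nlinarith

lemma tendsto_prodC (h : IsMoranSystem J n c Jw) : Tendsto (prodC c) atTop (nhds 0) := by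
  obtain ⟨D, hD, hdist⟩ := h.exists_dist_le
  obtain ⟨K, hK, hNK⟩ := h.prodN_mul_le hD hdist
  have hpos := prodC_pos h.c_pos
  have hbdd : BddBelow (Set.range (prodC c)) := ⟨0, by rintro _ ⟨k, rfl⟩; exact (hpos k).le⟩
  have hlim := tendsto_atTop_ciInf (prodC_strictAnti h.c_pos h.c_lt_one).antitone hbdd
  rcases (Real.iInf_nonneg fun k => (hpos k).le).eq_or_lt with h0 | h0
  · rwa [← h0] at hlim
  · exfalso
    obtain ⟨k, hk⟩ := pow_unbounded_of_one_lt (K / (⨅ k, prodC c k) ^ d) (one_lt_two (α := ℝ))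
    rw [div_lt_iff₀ (by positivity)] at hk
    refine hk.not_ge (le_trans ?_ (hNK k))
    gcongr
    · exact_mod_cast two_pow_le_prodN h.two_le_n k
    · exact ciInf_le hbdd k

lemma eventually_ratio_le (h : IsMoranSystem J n c Jw) :
    ∃ P : ℝ, ∀ᶠ k in atTop, Real.log (prodN n k : ℝ) / -Real.log (prodC c k) ≤ P := by
  obtain ⟨D, hD, hdist⟩ := h.exists_dist_le
  obtain ⟨K, hK, hNK⟩ := h.prodN_mul_le hD hdist
  refine ⟨|Real.log K| + d, ?_⟩
  have hpos := prodC_pos h.c_pos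
  have hev := h.tendsto_prodC.eventually (gt_mem_nhds (Real.exp_pos (-1)))
  filter_upwards [hev] with k hk
  have h1 : 1 ≤ -Real.log (prodC c k) := by
    have := Real.log_lt_log (hpos k) hk
    rw [Real.log_exp] at this
    linarith
  have hN : (0 : ℝ) < prodN n k := by exact_mod_cast prodN_pos h.two_le_n k
  have h2 := Real.log_le_log (by have := hpos k; positivity) (hNK k)
  rw [Real.log_mul hN.ne' (pow_pos (hpos k) d).ne', Real.log_pow] at h2
  rw [div_le_iff₀ (by linarith)]
  nlinarith [le_abs_self (Real.log K), abs_nonneg (Real.log K)]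

end IsMoranSystem

namespace MoranWord

variable {n : ℕ → ℕ} {k : ℕ}

lemma exists_ofSeq_eq (hn : ∀ k, 2 ≤ n k) (u : MoranWord n k) : ∃ ω, ofSeq ω k = u := by
  refine ⟨fun i => if hi : i < k then u ⟨i, hi⟩ else ⟨0, two_pos.trans_le (hn i)⟩, ?_⟩
  ext i
  simp [ofSeq]

/-- The infinite product of the uniform measures on the alphabets `Fin (n k)`. -/
def uniformMeasure (n : ℕ → ℕ) [∀ k, NeZero (n k)] : Measure (∀ k, Fin (n k)) :=
  Measure.infinitePi fun k => (PMF.uniformOfFintype (Fin (n k))).toMeasure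

variable [∀ k, NeZero (n k)]

instance : IsProbabilityMeasure (uniformMeasure n) :=
  inferInstanceAs (IsProbabilityMeasure (Measure.infinitePi _))

lemma uniformMeasure_real_cylinder (hn : ∀ k, 2 ≤ n k) (u : MoranWord n k) :
    (uniformMeasure n).real {ω | ofSeq ω k = u} = (prodN n k : ℝ)⁻¹ := by
  obtain ⟨ω₀, rfl⟩ := exists_ofSeq_eq hn u
  have hpi : {ω | ofSeq ω k = ofSeq ω₀ k} =
      Set.pi (Finset.range k) fun i => ({ω₀ i} : Set (Fin (n i))) := by
    ext ω
    simp only [Set.mem_ofPred_eq, Set.mem_pi, Finset.coe_range, Set.mem_Iio,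
      Set.mem_singleton_iff]
    exact ⟨fun h i hi => congrFun h ⟨i, hi⟩, fun h => funext fun i => h i i.2⟩
  rw [hpi, uniformMeasure, measureReal_def,
    Measure.infinitePi_pi _ fun i _ => MeasurableSet.singleton _, ENNReal.toReal_prod, prodN,
    Nat.cast_prod, ← Finset.prod_inv_distrib]
  refine Finset.prod_congr rfl fun i _ => ?_
  rw [PMF.toMeasure_apply_singleton _ _ (MeasurableSet.singleton _),
    PMF.uniformOfFintype_apply, Fintype.card_fin, ENNReal.toReal_inv, ENNReal.toReal_natCast]

end MoranWord

namespace IsMoranSystem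

variable {d : ℕ} {J : Set (EuclideanSpace ℝ (Fin d))} {n : ℕ → ℕ} {c : ℕ → ℝ}
  {Jw : List ℕ → Set (EuclideanSpace ℝ (Fin d))}

lemma exists_mem_cell (h : IsMoranSystem J n c Jw) (ω : ∀ k, Fin (n k)) :
    ∃ x, ∀ k, x ∈ Jw (MoranWord.ofSeq ω k).toList := by
  obtain ⟨x, hx⟩ := IsCompact.nonempty_iInter_of_sequence_nonempty_isCompact_isClosed
    (fun k => Jw (MoranWord.ofSeq ω k).toList)
    (fun k => h.subset_dropLast (MoranWord.ofSeq ω (k + 1)))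
    (fun k => h.nonempty_cell _) (h.isCompact_cell _) fun k => (h.isCompact_cell _).isClosed
  exact ⟨x, Set.mem_iInter.1 hx⟩

/-- The point of the Moran set coded by an infinite word. -/
def coding (h : IsMoranSystem J n c Jw) (ω : ∀ k, Fin (n k)) : EuclideanSpace ℝ (Fin d) :=
  (h.exists_mem_cell ω).choose

lemma coding_mem_cell (h : IsMoranSystem J n c Jw) (ω : ∀ k, Fin (n k)) (k : ℕ) :
    h.coding ω ∈ Jw (MoranWord.ofSeq ω k).toList :=
  (h.exists_mem_cell ω).choose_spec k

lemma coding_mem_moranSet (h : IsMoranSystem J n c Jw) (ω : ∀ k, Fin (n k)) :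
    h.coding ω ∈ moranSet n Jw :=
  mem_moranSet_iff.2 fun k => ⟨_, h.coding_mem_cell ω k⟩

lemma continuous_coding (h : IsMoranSystem J n c Jw) : Continuous h.coding := by
  obtain ⟨D, -, hdist⟩ := h.exists_dist_le
  refine continuous_iff_continuousAt.2 fun ω => Metric.tendsto_nhds.2 fun ε hε => ?_
  have h0 : Tendsto (fun k => prodC c k * D) atTop (nhds 0) := by
    simpa using h.tendsto_prodC.mul_const D
  obtain ⟨k, hk⟩ := (h0.eventually (gt_mem_nhds hε)).exists
  have hcyl : ∀ᶠ ω' in nhds ω, ∀ i : Fin k, ω' i = ω i := by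
    refine eventually_all.2 fun i => ?_
    have hi : Continuous fun ω' : ∀ k, Fin (n k) => ω' i := continuous_apply (i : ℕ)
    exact hi.continuousAt (mem_nhds_discrete.2 rfl : {j | j = ω i} ∈ nhds (ω i))
  filter_upwards [hcyl] with ω' hω'
  have heq : MoranWord.ofSeq ω' k = MoranWord.ofSeq ω k := funext hω'
  exact (hdist k _ _ (heq ▸ h.coding_mem_cell ω' k) _ (h.coding_mem_cell ω k)).trans_lt hk

theorem exists_isScaleMeasure (h : IsMoranSystem J n c Jw) :
    ∃ (μ : Measure (EuclideanSpace ℝ (Fin d))) (M D : ℝ), 0 < D ∧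
      IsScaleMeasure (moranSet n Jw) μ (fun r => (Phi n c D r : ℝ)) M D := by
  obtain ⟨D, hD, hdist⟩ := h.exists_dist_le
  obtain ⟨a, ha, hcard⟩ := h.exists_card_mul_le hD hdist
  obtain ⟨c₀, hc₀, hc⟩ := h.c_inf_pos
  obtain ⟨P, hP⟩ := h.eventually_ratio_le
  have hlim := h.tendsto_prodC
  have : ∀ k, NeZero (n k) := fun k => ⟨by have := h.two_le_n k; omega⟩
  have hmeas : Measurable h.coding := h.continuous_coding.measurable
  have hcyl {k : ℕ} := MoranWord.uniformMeasure_real_cylinder (k := k) h.two_le_n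
  have hone : ∀ r, (1 : ℝ) ≤ Phi n c D r := fun r => by
    exact_mod_cast prodN_pos h.two_le_n (levelOf c D r)
  refine ⟨(MoranWord.uniformMeasure n).map h.coding, (2 * D / (c₀ * a)) ^ d, D, hD, ?_⟩
  have hprob := Measure.isProbabilityMeasure_map (μ := MoranWord.uniformMeasure n)
    hmeas.aemeasurable
  refine ⟨hprob, ?_, by positivity, hD, hone, ?_, ?_, ?_, ?_⟩
  · refine le_antisymm prob_le_one ?_
    refine le_trans (le_of_eq ?_) (Measure.le_map_apply hmeas.aemeasurable _)
    rw [Set.preimage_eq_univ_iff.2 (Set.range_subset_iff.2 h.coding_mem_moranSet), measure_univ]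
  · intro x hx r hr _
    have hlt := prodC_levelOf_lt (D := D) hlim hr
    obtain ⟨u, hu⟩ := mem_moranSet_iff.1 hx (levelOf c D r)
    rw [map_measureReal_apply hmeas Metric.isClosed_closedBall.measurableSet, Phi, ← hcyl u]
    refine measureReal_mono fun ω (hω : MoranWord.ofSeq ω _ = u) => ?_
    exact (hdist _ u _ (hω ▸ h.coding_mem_cell ω _) _ hu).trans hlt.le
  · intro x r hr hrD
    have hlt := prodC_levelOf_lt (D := D) hlim hr
    have hle := le_prodC_levelOf hc₀ hc hlim hr hrD
    have hN := hone r
    rw [map_measureReal_apply hmeas Metric.isClosed_closedBall.measurableSet]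
    rw [Phi] at hN ⊢
    set k := levelOf c D r
    have hC := prodC_pos h.c_pos k
    classical
    let F : Finset (MoranWord n k) :=
      {u | (Jw u.toList ∩ Metric.closedBall x r).Nonempty}
    have hF := hcard k F x r hr.le fun u hu => (Finset.mem_filter.1 hu).2
    have hcov : h.coding ⁻¹' Metric.closedBall x r ⊆ ⋃ u ∈ F, {ω | MoranWord.ofSeq ω k = u} := by
      intro ω hω
      refine Set.mem_biUnion (x := MoranWord.ofSeq ω k) ?_ rfl
      exact Finset.mem_filter.2 ⟨Finset.mem_univ _, _, h.coding_mem_cell ω k, hω⟩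
    calc (MoranWord.uniformMeasure n).real (h.coding ⁻¹' Metric.closedBall x r)
        ≤ (MoranWord.uniformMeasure n).real (⋃ u ∈ F, {ω | MoranWord.ofSeq ω k = u}) :=
          measureReal_mono hcov (measure_ne_top _ _)
      _ ≤ ∑ u ∈ F, (MoranWord.uniformMeasure n).real {ω | MoranWord.ofSeq ω k = u} :=
          measureReal_biUnion_finset_le _ _
      _ = F.card * (prodN n k : ℝ)⁻¹ := by
          rw [Finset.sum_congr rfl fun u _ => hcyl u, Finset.sum_const, nsmul_eq_mul]
      _ ≤ (2 * D / (c₀ * a)) ^ d * (prodN n k : ℝ)⁻¹ := by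
          refine mul_le_mul_of_nonneg_right ?_ (by positivity)
          rw [← le_div_iff₀ (by positivity), ← div_pow] at hF
          refine hF.trans (pow_le_pow_left₀ (by positivity) ?_ d)
          rw [div_le_div_iff₀ (by positivity) (by positivity)]
          have h1 : (r + prodC c k * D) * c₀ ≤ 2 * (prodC c k * D) := by nlinarith
          nlinarith [mul_le_mul_of_nonneg_right h1 ha.le]
  · intro r hr _
    have hlt := prodC_levelOf_lt (D := D) hlim hr
    choose p hp using fun u : MoranWord n (levelOf c D r) => h.nonempty_cell u
    classical
    refine ⟨Finset.univ.image p, ?_, fun x hx => ?_⟩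
    · rw [Phi, ← MoranWord.card_eq]
      exact_mod_cast Finset.card_image_le
    · obtain ⟨u, hu⟩ := mem_moranSet_iff.1 hx (levelOf c D r)
      refine Set.mem_biUnion (Finset.mem_coe.2 (Finset.mem_image_of_mem p (Finset.mem_univ u))) ?_
      exact (hdist _ u _ hu _ (hp u)).trans hlt.le
  · exact isBoundedUnder_le_of_tendsto_sub
      (tendsto_log_Phi_sub n hc₀ hc h.c_lt_one hD hlim hP)
      ⟨P, (tendsto_levelOf h.c_pos h.c_lt_one hD hlim).eventually hP⟩

/-- The lower and upper limits of `log Φ(r) / -log r` as `r → 0` agree with those of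
`log (n₁ ⋯ n_k) / -log (c₁ ⋯ c_k)` as `k → ∞`. -/
lemma liminf_and_limsup_log_Phi (h : IsMoranSystem J n c Jw) {D : ℝ} (hD : 0 < D) :
    liminf (fun r => Real.log (Phi n c D r : ℝ) / -Real.log r) (nhdsWithin (0 : ℝ) (Set.Ioi 0)) =
        liminf (fun k => Real.log (prodN n k : ℝ) / -Real.log (prodC c k)) atTop ∧
      limsup (fun r => Real.log (Phi n c D r : ℝ) / -Real.log r)
          (nhdsWithin (0 : ℝ) (Set.Ioi 0)) =
        limsup (fun k => Real.log (prodN n k : ℝ) / -Real.log (prodC c k)) atTop := by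
  obtain ⟨c₀, hc₀, hc⟩ := h.c_inf_pos
  obtain ⟨P, hP⟩ := h.eventually_ratio_le
  have hlim := h.tendsto_prodC
  have hsub := tendsto_log_Phi_sub n hc₀ hc h.c_lt_one hD hlim hP
  have hle : (nhdsWithin (0 : ℝ) (Set.Ioi 0)).IsBoundedUnder (· ≤ ·) fun r =>
      Real.log (prodN n (levelOf c D r) : ℝ) / -Real.log (prodC c (levelOf c D r)) :=
    ⟨P, (tendsto_levelOf h.c_pos h.c_lt_one hD hlim).eventually hP⟩
  have hge : (nhdsWithin (0 : ℝ) (Set.Ioi 0)).IsBoundedUnder (· ≥ ·) fun r =>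
      Real.log (prodN n (levelOf c D r) : ℝ) / -Real.log (prodC c (levelOf c D r)) :=
    ⟨0, eventually_map.2 <| Eventually.of_forall fun r =>
      moranRatio_nonneg n h.c_pos h.c_lt_one (levelOf c D r)⟩
  rw [liminf_eq_of_tendsto_sub hsub hle hge, limsup_eq_of_tendsto_sub hsub hle hge,
    ← map_levelOf h.c_pos h.c_lt_one hD hlim]
  exact ⟨rfl, rfl⟩

end IsMoranSystem

/-- Dimensions of a Moran set:
`dim_H E = liminf_k log(n₁⋯n_k)/(−log(c₁⋯c_k))`,
`dim_P E = limsup_k log(n₁⋯n_k)/(−log(c₁⋯c_k))`, and the lower and upper box-counting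
dimensions equal the same liminf and limsup. -/
theorem statement6 {d : ℕ} (J : Set (EuclideanSpace ℝ (Fin d))) (n : ℕ → ℕ) (c : ℕ → ℝ)
    (Jw : List ℕ → Set (EuclideanSpace ℝ (Fin d))) (h : IsMoranSystem J n c Jw) :
    dimH (moranSet n Jw) = ENNReal.ofReal (Filter.liminf
        (fun k : ℕ => Real.log (prodN n k : ℝ) / (-Real.log (prodC c k))) Filter.atTop) ∧
      packDim (moranSet n Jw) = Filter.limsup
        (fun k : ℕ => Real.log (prodN n k : ℝ) / (-Real.log (prodC c k))) Filter.atTop ∧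
      lowerBoxDim (moranSet n Jw) = Filter.liminf
        (fun k : ℕ => Real.log (prodN n k : ℝ) / (-Real.log (prodC c k))) Filter.atTop ∧
      upperBoxDim (moranSet n Jw) = Filter.limsup
        (fun k : ℕ => Real.log (prodN n k : ℝ) / (-Real.log (prodC c k))) Filter.atTop := by
  obtain ⟨μ, M, D, hD, hμ⟩ := h.exists_isScaleMeasure
  obtain ⟨hinf, hsup⟩ := h.liminf_and_limsup_log_Phi hD
  rw [hμ.dimH_eq, hμ.packDim_eq, hμ.lowerBoxDim_eq, hμ.upperBoxDim_eq, hinf, hsup]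
  exact ⟨rfl, rfl, rfl, rfl⟩

end
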